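/- arXiv:2605.21155 — 2 statements merged into one kernel-verified Lean document; each statement's English description precedes it below -/
import Mathlib

section
/- Let σ > 1 and C ∈ (0,∞). Suppose n₁ = n₁(n) and n₂ = n₂(n) are sequences of positive integers tending to infinity with n₁ ∼ C n₂^{σ²} (log n₂)^{−(σ²−1)/2} as n → ∞. With aₘ = (2 log m)^{-1/2} and bₘ = (2 log m)^{1/2} − (log log m + log(4π)) / (2 (2 log m)^{1/2}), one has (b_{n₁} − σ b_{n₂}) / (σ a_{n₂}) → κ(C,σ) as n → ∞, where κ(C,σ) = (1/σ²) log(C/σ) + (1/2)(1 − 1/σ²) log(4π). -/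
open Real Filter
open scoped Topology

/-- The classical scaling constants for Gaussian maxima: `aₘ = (2 log m)^{-1/2}`. -/
noncomputable def gaussScaling (m : ℕ) : ℝ := (Real.sqrt (2 * Real.log m))⁻¹

/-- The classical centering constants for Gaussian maxima:
`bₘ = (2 log m)^{1/2} − (log log m + log 4π)/(2 (2 log m)^{1/2})`. -/
noncomputable def gaussCentering (m : ℕ) : ℝ :=
  Real.sqrt (2 * Real.log m)
    - (Real.log (Real.log m) + Real.log (4 * Real.pi)) / (2 * Real.sqrt (2 * Real.log m))

/-- `κ(C,σ) = (1/σ²) log(C/σ) + (1/2)(1 − 1/σ²) log(4π)`. -/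
noncomputable def kappa (C σ : ℝ) : ℝ :=
  (1 / σ ^ 2) * Real.log (C / σ) + (1 / 2) * (1 - 1 / σ ^ 2) * Real.log (4 * Real.pi)

/-- Exact decomposition of the normalized centering gap in terms of `s = √(2L)`, `t = √(2M)` and
`q = s / t`; the coefficient of `log M` carries the factor `q - σ`. -/
lemma centering_gap_decomposition {σ s t q l d c x : ℝ} (hσ : 0 < σ) (ht : 0 < t) (hq : 0 < q)
    (hs : s = q * t) (hd : s ^ 2 = σ ^ 2 * t ^ 2 - (σ ^ 2 - 1) * l + 2 * d) :
    ((s - (l + x + c) / (2 * s)) - σ * (t - (l + c) / (2 * t))) / (σ * t⁻¹) =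
      2 * d / (σ * (q + σ)) - (x + c) / (2 * σ * q) + c / 2 +
        (q - σ) * l * ((σ ^ 2 - 1) / (2 * σ ^ 2 * (q + σ)) + 1 / (2 * σ ^ 2 * q)) := by
  subst hs
  obtain rfl : d = ((q * t) ^ 2 - σ ^ 2 * t ^ 2 + (σ ^ 2 - 1) * l) / 2 := by linarith
  have hqσ : q + σ ≠ 0 := by positivity
  field_simp
  ring

lemma tendsto_ratio_and_sqrt_ratio_gap {σ d : ℝ} (hσ : 0 < σ) {L M : ℕ → ℝ}
    (hM : Tendsto M atTop atTop) (hL : ∀ᶠ n in atTop, 0 < L n)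
    (hd : Tendsto (fun n => L n - (σ ^ 2 * M n - (σ ^ 2 - 1) / 2 * log (M n))) atTop (𝓝 d)) :
    Tendsto (fun n => L n / M n) atTop (𝓝 (σ ^ 2)) ∧
      Tendsto (fun n => (√(L n / M n) - σ) * log (M n)) atTop (𝓝 0) := by
  have log_pow_div (k : ℕ) : Tendsto (fun n => log (M n) ^ k / M n) atTop (𝓝 0) := by
    simpa [Function.comp_def] using (Real.tendsto_pow_log_div_mul_add_atTop 1 0 k one_ne_zero).comp hM
  have hM0 := hM.eventually_gt_atTop 0
  have hratio : Tendsto (fun n => L n / M n) atTop (𝓝 (σ ^ 2)) := by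
    have h := ((hd.mul (log_pow_div 0)).sub ((log_pow_div 1).const_mul ((σ ^ 2 - 1) / 2))).const_add
      (σ ^ 2)
    simp only [mul_zero, sub_zero, add_zero] at h
    refine h.congr' ?_
    filter_upwards [hM0] with n hn
    field_simp
    ring
  refine ⟨hratio, ?_⟩
  have hsqrt : Tendsto (fun n => √(L n / M n)) atTop (𝓝 σ) := by
    simpa [Real.sqrt_sq hσ.le] using hratio.sqrt
  have h := ((hd.mul (log_pow_div 1)).sub
    ((log_pow_div 2).const_mul ((σ ^ 2 - 1) / 2))).div (hsqrt.add_const σ) (by positivity)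
  simp only [mul_zero, sub_zero, zero_div] at h
  refine h.congr' ?_
  filter_upwards [hM0, hL] with n hn hLn
  rw [Pi.div_apply]
  have hq : √(L n / M n) ^ 2 = L n / M n := Real.sq_sqrt (by positivity)
  have hq0 := Real.sqrt_nonneg (L n / M n)
  have hL' : L n = √(L n / M n) ^ 2 * M n := by rw [hq]; field_simp
  generalize √(L n / M n) = q at *
  have hqσ : q + σ ≠ 0 := by positivity
  rw [hL']
  field_simp
  ring

/-- Under the critical scaling `n₁ ∼ C n₂^{σ²} (log n₂)^{−(σ²−1)/2}`,
`(b_{n₁} − σ b_{n₂})/(σ a_{n₂}) → κ(C,σ)`. -/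
theorem centering_gap_limit_kappa
    (σ C : ℝ) (hσ : 1 < σ) (hC : 0 < C) (n₁ n₂ : ℕ → ℕ)
    (h₁ : Tendsto n₁ atTop atTop) (h₂ : Tendsto n₂ atTop atTop)
    (hasymp : Tendsto (fun n : ℕ => (n₁ n : ℝ) /
        (C * (n₂ n : ℝ) ^ (σ ^ 2) * (Real.log (n₂ n)) ^ (-((σ ^ 2 - 1) / 2))))
      atTop (𝓝 1)) :
    Tendsto (fun n : ℕ =>
        (gaussCentering (n₁ n) - σ * gaussCentering (n₂ n)) / (σ * gaussScaling (n₂ n)))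
      atTop (𝓝 (kappa C σ)) := by
  have hσ0 : 0 < σ := by linarith
  have hcast₁ : Tendsto (fun n => (n₁ n : ℝ)) atTop atTop := tendsto_natCast_atTop_atTop.comp h₁
  have hcast₂ : Tendsto (fun n => (n₂ n : ℝ)) atTop atTop := tendsto_natCast_atTop_atTop.comp h₂
  have hM : Tendsto (fun n => log (n₂ n)) atTop atTop := Real.tendsto_log_atTop.comp hcast₂
  have hL0 : ∀ᶠ n in atTop, 0 < log (n₁ n) :=
    (Real.tendsto_log_atTop.comp hcast₁).eventually_gt_atTop 0
  have hM0 := hM.eventually_gt_atTop 0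
  have hd : Tendsto (fun n => log (n₁ n) -
      (σ ^ 2 * log (n₂ n) - (σ ^ 2 - 1) / 2 * log (log (n₂ n)))) atTop (𝓝 (log C)) := by
    have h := (hasymp.log one_ne_zero).const_add (log C)
    rw [Real.log_one, add_zero] at h
    refine h.congr' ?_
    filter_upwards [hM0, hcast₁.eventually_gt_atTop 0, hcast₂.eventually_gt_atTop 0]
      with n hMn hn₁ hn₂
    rw [Real.log_div (by positivity) (by positivity), Real.log_mul (by positivity) (by positivity),
      Real.log_mul (by positivity) (by positivity), Real.log_rpow hn₂, Real.log_rpow hMn]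
    ring
  obtain ⟨hratio, hgap⟩ := tendsto_ratio_and_sqrt_ratio_gap hσ0 hM hL0 hd
  have hq : Tendsto (fun n => √(log (n₁ n) / log (n₂ n))) atTop (𝓝 σ) := by
    simpa [Real.sqrt_sq hσ0.le] using hratio.sqrt
  have hlog := hratio.log (by positivity)
  have hlim := ((((hd.const_mul 2).div ((hq.add_const σ).const_mul σ) (by positivity)).sub
    ((hlog.add_const (log (4 * π))).div (hq.const_mul (2 * σ)) (by positivity))).add_const
      (log (4 * π) / 2)).add (hgap.mul
        ((tendsto_const_nhds (x := σ ^ 2 - 1) |>.div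
            ((hq.add_const σ).const_mul (2 * σ ^ 2)) (by positivity)).add
          (tendsto_const_nhds (x := (1 : ℝ)) |>.div (hq.const_mul (2 * σ ^ 2)) (by positivity))))
  have hkappa : kappa C σ = 2 * log C / (σ * (σ + σ)) - (log (σ ^ 2) + log (4 * π)) / (2 * σ * σ) +
      log (4 * π) / 2 + 0 * ((σ ^ 2 - 1) / (2 * σ ^ 2 * (σ + σ)) + 1 / (2 * σ ^ 2 * σ)) := by
    rw [kappa, Real.log_div hC.ne' hσ0.ne', Real.log_pow]
    field_simp
    push_cast
    ring
  rw [hkappa]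
  refine hlim.congr' ?_
  filter_upwards [hL0, hM0] with n hLn hMn
  have hs : √(2 * log (n₁ n)) = √(log (n₁ n) / log (n₂ n)) * √(2 * log (n₂ n)) := by
    rw [← Real.sqrt_mul (by positivity)]
    congr 1
    field_simp
  have hloglog : log (log (n₁ n)) = log (log (n₂ n)) + log (log (n₁ n) / log (n₂ n)) := by
    rw [Real.log_div hLn.ne' hMn.ne']
    ring
  rw [gaussCentering, gaussCentering, gaussScaling, hloglog]
  refine (centering_gap_decomposition hσ0 (by positivity) (by positivity) hs ?_).symm
  rw [Real.sq_sqrt (by positivity), Real.sq_sqrt (by positivity)]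
  ring
end

section
/- Let σ > 1 and t ∈ ℝ, and let Λ₁ and Λ₂ be independent Gumbel random variables. Then P(Λ₁ > σ²(Λ₂ − t)) = ∫₀^∞ exp(−y − e^{−t} y^{1/σ²}) dy. -/
open MeasureTheory ProbabilityTheory Real Filter
open scoped ENNReal Topology

/-- The exponential distribution with parameter `1`, as a measure on `ℝ`. -/
noncomputable def unitExponential : Measure ℝ :=
  (volume.restrict (Set.Ioi 0)).withDensity fun y => ENNReal.ofReal (Real.exp (-y))

lemma lintegral_unitExponential {g : ℝ → ℝ≥0∞} (hg : Measurable g) :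
    ∫⁻ y, g y ∂unitExponential = ∫⁻ y in Set.Ioi 0, ENNReal.ofReal (Real.exp (-y)) * g y :=
  lintegral_withDensity_eq_lintegral_mul _ (by fun_prop) hg

lemma unitExponential_Ioi {z : ℝ} (hz : 0 ≤ z) :
    unitExponential (Set.Ioi z) = ENNReal.ofReal (Real.exp (-z)) := by
  rw [unitExponential, withDensity_apply _ measurableSet_Ioi,
    Measure.restrict_restrict measurableSet_Ioi, Set.Ioi_inter_Ioi, sup_eq_left.2 hz,
    ← integral_exp_neg_Ioi z, ofReal_integral_eq_lintegral_ofReal (integrableOn_exp_neg_Ioi z)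
      (.of_forall fun _ => (Real.exp_pos _).le)]

instance : NullSingletonClass unitExponential := by
  unfold unitExponential; infer_instance

lemma unitExponential_Ici_of_nonpos {z : ℝ} (hz : z ≤ 0) :
    unitExponential (Set.Ici z) = 1 := by
  have h : unitExponential (Set.Ioi 0) = 1 := by simp [unitExponential_Ioi le_rfl]
  rw [← h, unitExponential, withDensity_apply _ measurableSet_Ici,
    withDensity_apply _ measurableSet_Ioi, Measure.restrict_restrict measurableSet_Ici,
    Measure.restrict_restrict measurableSet_Ioi, Set.inter_self, Set.inter_eq_right.2]
  exact fun y hy => hz.trans (le_of_lt hy)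

/-- If `X` has the Gumbel distribution, then `exp (-X)` has the unit exponential distribution. -/
lemma map_exp_neg_of_gumbel {Ω : Type*} [MeasurableSpace Ω] (P : Measure Ω)
    [IsProbabilityMeasure P] {X : Ω → ℝ} (hX : Measurable X)
    (hcdf : ∀ x : ℝ, (P {ω | X ω ≤ x}).toReal = Real.exp (-Real.exp (-x))) :
    P.map (fun ω => Real.exp (-X ω)) = unitExponential := by
  have hY : Measurable fun ω => Real.exp (-X ω) := by fun_prop
  refine Measure.ext_of_Ici _ _ fun a => ?_
  rw [Measure.map_apply hY measurableSet_Ici]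
  rcases le_or_gt a 0 with ha | ha
  · have huniv : (fun ω => Real.exp (-X ω)) ⁻¹' Set.Ici a = Set.univ :=
      Set.eq_univ_of_forall fun ω => ha.trans (Real.exp_pos _).le
    rw [huniv, measure_univ, unitExponential_Ici_of_nonpos ha]
  · have hpre : (fun ω => Real.exp (-X ω)) ⁻¹' Set.Ici a = {ω | X ω ≤ -Real.log a} := by
      ext ω
      rw [Set.mem_preimage, Set.mem_Ici, Set.mem_ofPred_eq, ← Real.log_le_iff_le_exp ha, le_neg]
    rw [hpre, ← measure_congr Ioi_ae_eq_Ici, unitExponential_Ioi ha.le,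
      ← ENNReal.ofReal_toReal (measure_ne_top P _), hcdf, neg_neg, Real.exp_log ha]

lemma mul_sub_lt_iff_exp_neg_lt {c : ℝ} (hc : 0 < c) (t x y : ℝ) :
    c * (y - t) < x ↔ Real.exp (-t) * Real.exp (-x) ^ (1 / c) < Real.exp (-y) := by
  rw [← Real.exp_mul, ← Real.exp_add, Real.exp_lt_exp, mul_comm c, ← lt_div_iff₀ hc, neg_mul,
    mul_one_div]
  constructor <;> intro h <;> linarith

/-- For independent Gumbel random variables `Λ₁, Λ₂` and `σ > 1`, `t ∈ ℝ`,
`P(Λ₁ > σ²(Λ₂ − t)) = ∫₀^∞ exp(−y − e^{−t} y^{1/σ²}) dy`. -/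
theorem gumbel_comparison_integral
    {Ω : Type*} [MeasurableSpace Ω] (P : Measure Ω) [IsProbabilityMeasure P]
    (σ t : ℝ) (hσ : 1 < σ)
    (Λ₁ Λ₂ : Ω → ℝ) (hmeas₁ : Measurable Λ₁) (hmeas₂ : Measurable Λ₂)
    (hindep : IndepFun Λ₁ Λ₂ P)
    (hcdf₁ : ∀ x : ℝ, (P {ω | Λ₁ ω ≤ x}).toReal = Real.exp (-Real.exp (-x)))
    (hcdf₂ : ∀ x : ℝ, (P {ω | Λ₂ ω ≤ x}).toReal = Real.exp (-Real.exp (-x))) :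
    (P {ω | Λ₁ ω > σ ^ 2 * (Λ₂ ω - t)}).toReal
      = ∫ y in Set.Ioi (0 : ℝ), Real.exp (-y - Real.exp (-t) * y ^ (1 / σ ^ 2)) := by
  let Y₁ : Ω → ℝ := fun ω => Real.exp (-Λ₁ ω)
  let Y₂ : Ω → ℝ := fun ω => Real.exp (-Λ₂ ω)
  have hY₁ : Measurable Y₁ := by fun_prop
  have hY₂ : Measurable Y₂ := by fun_prop
  have hlaw₁ : P.map Y₁ = unitExponential := map_exp_neg_of_gumbel P hmeas₁ hcdf₁
  have hlaw₂ : P.map Y₂ = unitExponential := map_exp_neg_of_gumbel P hmeas₂ hcdf₂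
  have hindepY : IndepFun Y₁ Y₂ P :=
    hindep.comp (φ := fun x : ℝ => Real.exp (-x)) (ψ := fun x : ℝ => Real.exp (-x))
      (by fun_prop) (by fun_prop)
  have hjoint := (indepFun_iff_map_prod_eq_prod_map_map hY₁.aemeasurable hY₂.aemeasurable).1 hindepY
  rw [hlaw₁, hlaw₂] at hjoint
  have hfin : IsFiniteMeasure unitExponential := hlaw₁ ▸ inferInstance
  let S : Set (ℝ × ℝ) := {p | Real.exp (-t) * p.1 ^ (1 / σ ^ 2) < p.2}
  have hS : MeasurableSet S := measurableSet_lt (by fun_prop) (by fun_prop)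
  have hevent : {ω | Λ₁ ω > σ ^ 2 * (Λ₂ ω - t)} = (fun ω => (Y₁ ω, Y₂ ω)) ⁻¹' S := by
    ext ω
    exact mul_sub_lt_iff_exp_neg_lt (by positivity) t (Λ₁ ω) (Λ₂ ω)
  rw [hevent, ← Measure.map_apply (hY₁.prodMk hY₂) hS, hjoint, Measure.prod_apply hS,
    lintegral_unitExponential (measurable_measure_prodMk_left hS),
    integral_eq_lintegral_of_nonneg_ae (.of_forall fun _ => (Real.exp_pos _).le)
      (by fun_prop)]
  congr 1
  refine setLIntegral_congr_fun measurableSet_Ioi fun y hy => ?_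
  have hz : 0 ≤ Real.exp (-t) * y ^ (1 / σ ^ 2) :=
    mul_nonneg (Real.exp_pos _).le (Real.rpow_nonneg (le_of_lt hy) _)
  have hsection : Prod.mk y ⁻¹' S = Set.Ioi (Real.exp (-t) * y ^ (1 / σ ^ 2)) := rfl
  rw [hsection, unitExponential_Ioi hz, ← ENNReal.ofReal_mul (Real.exp_pos _).le, ← Real.exp_add,
    sub_eq_add_neg]
end
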